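/- arXiv:2307.05540 — 2 statements merged into one kernel-verified Lean document; each statement's English description precedes it below -/
import Mathlib

section
/- Finite presentability of a skew brace is independent of the chosen generating set: if a skew brace B is finitely presented by generators a_1,…,a_m subject to n relations ρ_1 = … = ρ_n = 1, and b_1,…,b_l is any other finite generating set of B, then B admits a finite presentation on the generators b_1,…,b_l subject to l + n relations. In particular, for every finite generating set b_1,…,b_l of a finitely presented skew brace B, the kernel of the surjective homomorphism from the free skew brace on l generators sending the i-th generator to b_i is finitely generated as an ideal. -/
universe u v

/-- A skew (left) brace: two group structures `(B,+)` and `(B,∘)` on the same set,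
sharing the same identity element `zero` (recall that in any skew brace `0 = 1`),
satisfying the skew left distributive law `a ∘ (b + c) = a ∘ b - a + a ∘ c`. -/
structure SkewBrace (B : Type u) where
  add : B → B → B
  zero : B
  neg : B → B
  mul : B → B → B
  inv : B → B
  add_assoc : ∀ a b c, add (add a b) c = add a (add b c)
  zero_add : ∀ a, add zero a = a
  add_zero : ∀ a, add a zero = a
  neg_add : ∀ a, add (neg a) a = zero
  add_neg : ∀ a, add a (neg a) = zero
  mul_assoc : ∀ a b c, mul (mul a b) c = mul a (mul b c)
  zero_mul : ∀ a, mul zero a = a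
  mul_zero : ∀ a, mul a zero = a
  inv_mul : ∀ a, mul (inv a) a = zero
  mul_inv : ∀ a, mul a (inv a) = zero
  compat : ∀ a b c, mul a (add b c) = add (add (mul a b) (neg a)) (mul a c)

namespace SkewBrace

variable {B C Q : Type u}

/-- `λ_a (b) = -a + a ∘ b`. -/
def lam (S : SkewBrace B) (a b : B) : B := S.add (S.neg a) (S.mul a b)

/-- `a ∗ b = λ_a(b) - b = -a + a ∘ b - b`. -/
def star (S : SkewBrace B) (a b : B) : B := S.add (S.lam a b) (S.neg b)

/-- A sub-skew brace: a subset containing the identity and closed under both group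
operations and both inverses. -/
def IsSub (S : SkewBrace B) (T : Set B) : Prop :=
  S.zero ∈ T ∧ (∀ a ∈ T, ∀ b ∈ T, S.add a b ∈ T) ∧ (∀ a ∈ T, S.neg a ∈ T) ∧
    (∀ a ∈ T, ∀ b ∈ T, S.mul a b ∈ T) ∧ (∀ a ∈ T, S.inv a ∈ T)

/-- The sub-skew brace generated by a subset. -/
def subGen (S : SkewBrace B) (X : Set B) : Set B := ⋂₀ {T | S.IsSub T ∧ X ⊆ T}

/-- A skew brace is finitely generated if a finite subset generates it. -/
def FinitelyGenerated (S : SkewBrace B) : Prop := ∃ T : Finset B, S.subGen ↑T = Set.univ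

/-- A subgroup of the additive group `(B,+)`. -/
def IsAddSubgroup (S : SkewBrace B) (T : Set B) : Prop :=
  S.zero ∈ T ∧ (∀ a ∈ T, ∀ b ∈ T, S.add a b ∈ T) ∧ ∀ a ∈ T, S.neg a ∈ T

/-- A subgroup of the multiplicative group `(B,∘)`. -/
def IsMulSubgroup (S : SkewBrace B) (T : Set B) : Prop :=
  S.zero ∈ T ∧ (∀ a ∈ T, ∀ b ∈ T, S.mul a b ∈ T) ∧ ∀ a ∈ T, S.inv a ∈ T

/-- The additive subgroup generated by a subset. -/
def addClosure (S : SkewBrace B) (X : Set B) : Set B := ⋂₀ {T | S.IsAddSubgroup T ∧ X ⊆ T}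

/-- The multiplicative subgroup generated by a subset. -/
def mulClosure (S : SkewBrace B) (X : Set B) : Set B := ⋂₀ {T | S.IsMulSubgroup T ∧ X ⊆ T}

/-- The group `(B,+)` is finitely generated. -/
def AddFG (S : SkewBrace B) : Prop := ∃ T : Finset B, S.addClosure ↑T = Set.univ

/-- The group `(B,∘)` is finitely generated. -/
def MulFG (S : SkewBrace B) : Prop := ∃ T : Finset B, S.mulClosure ↑T = Set.univ

/-- An ideal of a skew brace: a subgroup of `(B,+)`, normal in `(B,+)` and in `(B,∘)`,
invariant under all the maps `λ_b`. -/
def IsIdeal (S : SkewBrace B) (I : Set B) : Prop :=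
  S.IsAddSubgroup I ∧ (∀ b : B, ∀ a ∈ I, S.add (S.add b a) (S.neg b) ∈ I) ∧
    (∀ b : B, ∀ a ∈ I, S.mul (S.mul b a) (S.inv b) ∈ I) ∧
    ∀ b : B, ∀ a ∈ I, S.lam b a ∈ I

/-- The ideal generated by a subset (the smallest ideal containing it). -/
def idealGen (S : SkewBrace B) (X : Set B) : Set B := ⋂₀ {I | S.IsIdeal I ∧ X ⊆ I}

/-- A homomorphism of skew braces. -/
def IsHom (S : SkewBrace B) (T : SkewBrace C) (f : B → C) : Prop :=
  (∀ a b, f (S.add a b) = T.add (f a) (f b)) ∧ ∀ a b, f (S.mul a b) = T.mul (f a) (f b)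

/-- `SF` together with `ι : X → F` is the free skew brace on `X`: every map from `X`
to a skew brace extends uniquely to a homomorphism. -/
def IsFreeOn {F : Type u} {X : Type v} (SF : SkewBrace F) (ι : X → F) : Prop :=
  ∀ (C : Type u) (SC : SkewBrace C) (f : X → C),
    ∃! g : F → C, IsHom SF SC g ∧ ∀ x, g (ι x) = f x

/-- A skew brace is finitely presented if it is the image of a free skew brace on a
finite set under a homomorphism whose kernel is generated, as an ideal, by finitely
many elements. -/
def FinitelyPresented (S : SkewBrace B) : Prop :=
  ∃ (F : Type u) (SF : SkewBrace F) (m : ℕ) (ι : Fin m → F) (θ : F → B),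
    IsFreeOn SF ι ∧ IsHom SF S θ ∧ Function.Surjective θ ∧
      ∃ R : Finset F, {x | θ x = S.zero} = SF.idealGen ↑R

/-- `π : B → Q` realizes `Q` as the quotient skew brace `B/I`. -/
def IsQuotientBy (S : SkewBrace B) (I : Set B) (SQ : SkewBrace Q) (π : B → Q) : Prop :=
  IsHom S SQ π ∧ Function.Surjective π ∧ {x | π x = SQ.zero} = I

/-- The group `(B,+)` is finitely presented (as an abstract group). -/
def AddFP (S : SkewBrace B) : Prop :=
  ∃ (m : ℕ) (f : FreeGroup (Fin m) → B),
    (∀ x y, f (x * y) = S.add (f x) (f y)) ∧ Function.Surjective f ∧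
      ∃ R : Finset (FreeGroup (Fin m)),
        {x | f x = S.zero} = ↑(Subgroup.normalClosure (R : Set (FreeGroup (Fin m))))

/-- The group `(B,∘)` is finitely presented (as an abstract group). -/
def MulFP (S : SkewBrace B) : Prop :=
  ∃ (m : ℕ) (f : FreeGroup (Fin m) → B),
    (∀ x y, f (x * y) = S.mul (f x) (f y)) ∧ Function.Surjective f ∧
      ∃ R : Finset (FreeGroup (Fin m)),
        {x | f x = S.zero} = ↑(Subgroup.normalClosure (R : Set (FreeGroup (Fin m))))

/-- The ascending chain condition on sub-skew braces. -/
def SubACC (S : SkewBrace B) : Prop :=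
  ∀ f : ℕ → Set B, Monotone f → (∀ n, S.IsSub (f n)) → ∃ n, ∀ m, n ≤ m → f m = f n

/-- The ascending chain condition on subgroups of `(B,+)`. -/
def AddACC (S : SkewBrace B) : Prop :=
  ∀ f : ℕ → Set B, Monotone f → (∀ n, S.IsAddSubgroup (f n)) → ∃ n, ∀ m, n ≤ m → f m = f n

/-- The socle `Soc(B) = Ker(λ) ∩ Z(B,+)`. -/
def soc (S : SkewBrace B) : Set B :=
  {x | (∀ b, S.lam x b = b) ∧ ∀ b, S.add x b = S.add b x}

/-- The centre of the additive group `(B,+)`. -/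
def addCenter (S : SkewBrace B) : Set B := {x | ∀ b, S.add x b = S.add b x}

/-- The preimage in `B` of `Ann(B/I)` (for `I` an ideal): the set of `x` such that,
modulo `I`, `λ_x = id`, `x` is central in `(B,+)` and `x` is central in `(B,∘)`. -/
def annStep (S : SkewBrace B) (I : Set B) : Set B :=
  {x | (∀ b, S.add (S.lam x b) (S.neg b) ∈ I) ∧
       (∀ b, S.add (S.add x b) (S.neg (S.add b x)) ∈ I) ∧
       ∀ b, S.mul (S.mul x b) (S.inv (S.mul b x)) ∈ I}

/-- The preimage in `B` of `Soc(B/I)` (for `I` an ideal). -/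
def socStep (S : SkewBrace B) (I : Set B) : Set B :=
  {x | (∀ b, S.add (S.lam x b) (S.neg b) ∈ I) ∧
       ∀ b, S.add (S.add x b) (S.neg (S.add b x)) ∈ I}

/-- The upper annihilator series `Ann_α(B)`, defined by transfinite recursion. -/
noncomputable def annSeries (S : SkewBrace B) (o : Ordinal.{v}) : Set B :=
  Ordinal.limitRecOn o {S.zero} (fun _ ih => S.annStep ih)
    fun _o _ ih => ⋃ β, ⋃ h : β < _o, ih β h

/-- The upper socle series `Soc_α(B)`, defined by transfinite recursion. -/
noncomputable def socSeries (S : SkewBrace B) (o : Ordinal.{v}) : Set B :=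
  Ordinal.limitRecOn o {S.zero} (fun _ ih => S.socStep ih)
    fun _o _ ih => ⋃ β, ⋃ h : β < _o, ih β h

/-- The solution of the YBE associated with a skew brace:
`r_B(a,b) = (λ_a(b), λ_a(b)⁻¹ ∘ a ∘ b)`. -/
def braceR (S : SkewBrace B) : B × B → B × B :=
  fun p => (S.lam p.1 p.2, S.mul (S.inv (S.lam p.1 p.2)) (S.mul p.1 p.2))

end SkewBrace

/-- The set-theoretic Yang–Baxter (braid) equation
`(r × id)(id × r)(r × id) = (id × r)(r × id)(id × r)`. -/
def ybe {X : Type u} (r : X × X → X × X) : Prop :=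
  let r₁ : X × X × X → X × X × X := fun p =>
    ((r (p.1, p.2.1)).1, (r (p.1, p.2.1)).2, p.2.2)
  let r₂ : X × X × X → X × X × X := fun p => (p.1, r p.2)
  r₁ ∘ r₂ ∘ r₁ = r₂ ∘ r₁ ∘ r₂

/-- A non-degenerate set-theoretic solution: `r` is bijective, satisfies the YBE, and
writing `r (x,y) = (σ_x y, τ_y x)`, all maps `σ_x` and `τ_y` are bijective. -/
def IsNonDegenerateSolution {X : Type u} (r : X × X → X × X) : Prop :=
  Function.Bijective r ∧ ybe r ∧
    (∀ x, Function.Bijective fun y => (r (x, y)).1) ∧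
    ∀ y, Function.Bijective fun x => (r (x, y)).2

/-- `S` (with the distinguished map `ι : X → B`) is the structure skew brace of the
solution `(X,r)`: the multiplicative group of `S` is the structure group
`G(X,r) = ⟨X | x y = σ_x(y) τ_y(x)⟩` (expressed by the relations holding together
with the universal property of the presentation) and `r_S ∘ (ι × ι) = (ι × ι) ∘ r`. -/
def IsStructureSkewBrace {X B : Type u} (r : X × X → X × X)
    (S : SkewBrace B) (ι : X → B) : Prop :=
  (∀ x y, S.mul (ι x) (ι y) = S.mul (ι (r (x, y)).1) (ι (r (x, y)).2)) ∧
  (∀ (H : Type u) [Group H] (f : X → H),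
      (∀ x y, f x * f y = f (r (x, y)).1 * f (r (x, y)).2) →
      ∃! φ : B → H, (∀ a b, φ (S.mul a b) = φ a * φ b) ∧ ∀ x, φ (ι x) = f x) ∧
  ∀ x y, S.braceR (ι x, ι y) = (ι (r (x, y)).1, ι (r (x, y)).2)

namespace SkewBrace

section Basic

variable {B C D : Type u}

theorem neg_add_cancel_left (S : SkewBrace B) (a b : B) : S.add (S.neg a) (S.add a b) = b := by
  rw [← S.add_assoc, S.neg_add, S.zero_add]

theorem add_neg_cancel_left (S : SkewBrace B) (a b : B) : S.add a (S.add (S.neg a) b) = b := by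
  rw [← S.add_assoc, S.add_neg, S.zero_add]

theorem mul_inv_cancel_left (S : SkewBrace B) (a b : B) : S.mul a (S.mul (S.inv a) b) = b := by
  rw [← S.mul_assoc, S.mul_inv, S.zero_mul]

theorem inv_mul_cancel_left (S : SkewBrace B) (a b : B) : S.mul (S.inv a) (S.mul a b) = b := by
  rw [← S.mul_assoc, S.inv_mul, S.zero_mul]

theorem eq_neg_of_add_eq_zero (S : SkewBrace B) {a b : B} (h : S.add a b = S.zero) :
    b = S.neg a := by
  rw [← S.neg_add_cancel_left a b, h, S.add_zero]

theorem eq_inv_of_mul_eq_zero (S : SkewBrace B) {a b : B} (h : S.mul a b = S.zero) :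
    b = S.inv a := by
  rw [← S.inv_mul_cancel_left a b, h, S.mul_zero]

theorem neg_neg (S : SkewBrace B) (a : B) : S.neg (S.neg a) = a :=
  (S.eq_neg_of_add_eq_zero (S.neg_add a)).symm

theorem inv_inv (S : SkewBrace B) (a : B) : S.inv (S.inv a) = a :=
  (S.eq_inv_of_mul_eq_zero (S.inv_mul a)).symm

theorem mul_eq_add_lam (S : SkewBrace B) (a b : B) : S.mul a b = S.add a (S.lam a b) :=
  (S.add_neg_cancel_left a _).symm

theorem mul_add_eq_add_lam (S : SkewBrace B) (a b c : B) :
    S.mul a (S.add b c) = S.add (S.mul a b) (S.lam a c) := by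
  rw [S.compat, S.add_assoc, lam]

theorem mul_lam_inv (S : SkewBrace B) (a b : B) : S.mul a (S.lam (S.inv a) b) = S.add a b := by
  have h := S.mul_add_eq_add_lam (S.inv a) a b
  rw [S.inv_mul, S.zero_add] at h
  rw [← h, S.mul_inv_cancel_left]

namespace IsHom

variable {S : SkewBrace B} {T : SkewBrace C} {U : SkewBrace D} {f : B → C} {g : C → D}

theorem comp (hg : IsHom T U g) (hf : IsHom S T f) : IsHom S U (g ∘ f) :=
  ⟨fun a b => by simp only [Function.comp, hf.1, hg.1],
    fun a b => by simp only [Function.comp, hf.2, hg.2]⟩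

theorem map_zero (hf : IsHom S T f) : f S.zero = T.zero := by
  have h := hf.1 S.zero S.zero
  rw [S.zero_add] at h
  rw [← T.neg_add_cancel_left (f S.zero) (f S.zero), ← h, T.neg_add]

theorem map_neg (hf : IsHom S T f) (a : B) : f (S.neg a) = T.neg (f a) :=
  T.eq_neg_of_add_eq_zero (by rw [← hf.1, S.add_neg, hf.map_zero])

theorem map_inv (hf : IsHom S T f) (a : B) : f (S.inv a) = T.inv (f a) :=
  T.eq_inv_of_mul_eq_zero (by rw [← hf.2, S.mul_inv, hf.map_zero])

theorem map_lam (hf : IsHom S T f) (a b : B) : f (S.lam a b) = T.lam (f a) (f b) := by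
  rw [lam, hf.1, hf.map_neg, hf.2, lam]

theorem isSub_range (hf : IsHom S T f) : T.IsSub (Set.range f) := by
  refine ⟨⟨S.zero, hf.map_zero⟩, ?_, ?_, ?_, ?_⟩
  · rintro _ ⟨a, rfl⟩ _ ⟨b, rfl⟩
    exact ⟨_, hf.1 a b⟩
  · rintro _ ⟨a, rfl⟩
    exact ⟨_, hf.map_neg a⟩
  · rintro _ ⟨a, rfl⟩ _ ⟨b, rfl⟩
    exact ⟨_, hf.2 a b⟩
  · rintro _ ⟨a, rfl⟩
    exact ⟨_, hf.map_inv a⟩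

theorem surjective_of_subGen_eq_univ (hf : IsHom S T f) {X : Set C} (hX : X ⊆ Set.range f)
    (hgen : T.subGen X = Set.univ) : Function.Surjective f := fun c =>
  Set.mem_sInter.1 (hgen ▸ Set.mem_univ c : c ∈ T.subGen X) _ ⟨hf.isSub_range, hX⟩

theorem isIdeal_preimage (hf : IsHom S T f) {I : Set C} (hI : T.IsIdeal I) :
    S.IsIdeal (f ⁻¹' I) := by
  obtain ⟨⟨h0, hadd, hneg⟩, hconj, hmconj, hlam⟩ := hI
  refine ⟨⟨?_, fun a ha b hb => ?_, fun a ha => ?_⟩, fun b a ha => ?_, fun b a ha => ?_,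
    fun b a ha => ?_⟩ <;> rw [Set.mem_preimage]
  · rwa [hf.map_zero]
  · rw [hf.1]
    exact hadd _ ha _ hb
  · rw [hf.map_neg]
    exact hneg _ ha
  · rw [hf.1, hf.1, hf.map_neg]
    exact hconj _ _ ha
  · rw [hf.2, hf.2, hf.map_inv]
    exact hmconj _ _ ha
  · rw [hf.map_lam]
    exact hlam _ _ ha

end IsHom

theorem isIdeal_zero (S : SkewBrace B) : S.IsIdeal {S.zero} := by
  simp [IsIdeal, IsAddSubgroup, lam, S.add_zero, S.add_neg, S.mul_zero, S.mul_inv, S.neg_add,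
    ← S.eq_neg_of_add_eq_zero (S.zero_add S.zero)]

theorem IsHom.isIdeal_ker {S : SkewBrace B} {T : SkewBrace C} {f : B → C} (hf : IsHom S T f) :
    S.IsIdeal {x | f x = T.zero} :=
  hf.isIdeal_preimage T.isIdeal_zero

theorem subset_idealGen (S : SkewBrace B) (X : Set B) : X ⊆ S.idealGen X :=
  Set.subset_sInter fun _ h => h.2

theorem idealGen_subset (S : SkewBrace B) {X I : Set B} (hI : S.IsIdeal I) (hX : X ⊆ I) :
    S.idealGen X ⊆ I :=
  Set.sInter_subset_of_mem ⟨hI, hX⟩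

theorem isIdeal_idealGen (S : SkewBrace B) (X : Set B) : S.IsIdeal (S.idealGen X) :=
  ⟨⟨fun _ h => h.1.1.1, fun a ha b hb I h => h.1.1.2.1 a (ha I h) b (hb I h),
      fun a ha I h => h.1.1.2.2 a (ha I h)⟩,
    fun b a ha I h => h.1.2.1 b a (ha I h), fun b a ha I h => h.1.2.2.1 b a (ha I h),
    fun b a ha I h => h.1.2.2.2 b a (ha I h)⟩

/-- Congruence modulo an ideal. -/
def IsIdeal.setoid {S : SkewBrace B} {I : Set B} (hI : S.IsIdeal I) : Setoid B where
  r a b := ∃ j ∈ I, b = S.add a j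
  iseqv := by
    refine ⟨fun a => ⟨S.zero, hI.1.1, (S.add_zero a).symm⟩, ?_, ?_⟩
    · rintro a _ ⟨j, hj, rfl⟩
      exact ⟨S.neg j, hI.1.2.2 j hj, by rw [S.add_assoc, S.add_neg, S.add_zero]⟩
    · rintro a _ _ ⟨j, hj, rfl⟩ ⟨k, hk, rfl⟩
      exact ⟨S.add j k, hI.1.2.1 j hj k hk, S.add_assoc _ _ _⟩

namespace IsIdeal

variable {S : SkewBrace B} {I : Set B} (hI : S.IsIdeal I)

theorem setoid_add {a a' b b' : B} (ha : hI.setoid.r a a') (hb : hI.setoid.r b b') :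
    hI.setoid.r (S.add a b) (S.add a' b') := by
  obtain ⟨j, hj, rfl⟩ := ha
  obtain ⟨k, hk, rfl⟩ := hb
  refine ⟨_, hI.1.2.1 _ (hI.2.1 (S.neg b) j hj) k hk, ?_⟩
  simp only [S.add_assoc, S.neg_neg, S.add_neg_cancel_left]

theorem setoid_mul {a a' b b' : B} (ha : hI.setoid.r a a') (hb : hI.setoid.r b b') :
    hI.setoid.r (S.mul a b) (S.mul a' b') := by
  obtain ⟨j, hj, rfl⟩ := ha
  obtain ⟨k, hk, rfl⟩ := hb
  have hj' := hI.2.2.1 (S.inv b) _ (hI.2.2.2 (S.inv a) j hj)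
  refine ⟨_, hI.1.2.1 _ (hI.2.2.2 (S.mul a b) _ hj') _ (hI.2.2.2 (S.add a j) k hk), ?_⟩
  rw [S.mul_add_eq_add_lam, ← S.add_assoc, ← S.mul_eq_add_lam, ← S.mul_lam_inv a j]
  simp only [S.mul_assoc, S.inv_inv, S.mul_inv_cancel_left]

theorem setoid_neg {a b : B} (h : hI.setoid.r a b) : hI.setoid.r (S.neg a) (S.neg b) := by
  have := hI.setoid_add (hI.setoid_add (hI.setoid.refl (S.neg a)) (hI.setoid.symm h))
    (hI.setoid.refl (S.neg b))
  rw [S.neg_add, S.zero_add, S.add_assoc, S.add_neg, S.add_zero] at this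
  exact this

theorem setoid_inv {a b : B} (h : hI.setoid.r a b) : hI.setoid.r (S.inv a) (S.inv b) := by
  have := hI.setoid_mul (hI.setoid_mul (hI.setoid.refl (S.inv a)) (hI.setoid.symm h))
    (hI.setoid.refl (S.inv b))
  rw [S.inv_mul, S.zero_mul, S.mul_assoc, S.mul_inv, S.mul_zero] at this
  exact this

/-- The quotient of a skew brace by an ideal. -/
def quotient : SkewBrace (Quotient hI.setoid) where
  add := Quotient.map₂ S.add fun _ _ ha _ _ hb => hI.setoid_add ha hb
  zero := Quotient.mk _ S.zero
  neg := Quotient.map S.neg fun _ _ h => hI.setoid_neg h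
  mul := Quotient.map₂ S.mul fun _ _ ha _ _ hb => hI.setoid_mul ha hb
  inv := Quotient.map S.inv fun _ _ h => hI.setoid_inv h
  add_assoc := by
    rintro ⟨a⟩ ⟨b⟩ ⟨c⟩
    exact congrArg (Quotient.mk _) (S.add_assoc a b c)
  zero_add := by
    rintro ⟨a⟩
    exact congrArg (Quotient.mk _) (S.zero_add a)
  add_zero := by
    rintro ⟨a⟩
    exact congrArg (Quotient.mk _) (S.add_zero a)
  neg_add := by
    rintro ⟨a⟩
    exact congrArg (Quotient.mk _) (S.neg_add a)
  add_neg := by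
    rintro ⟨a⟩
    exact congrArg (Quotient.mk _) (S.add_neg a)
  mul_assoc := by
    rintro ⟨a⟩ ⟨b⟩ ⟨c⟩
    exact congrArg (Quotient.mk _) (S.mul_assoc a b c)
  zero_mul := by
    rintro ⟨a⟩
    exact congrArg (Quotient.mk _) (S.zero_mul a)
  mul_zero := by
    rintro ⟨a⟩
    exact congrArg (Quotient.mk _) (S.mul_zero a)
  inv_mul := by
    rintro ⟨a⟩
    exact congrArg (Quotient.mk _) (S.inv_mul a)
  mul_inv := by
    rintro ⟨a⟩
    exact congrArg (Quotient.mk _) (S.mul_inv a)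
  compat := by
    rintro ⟨a⟩ ⟨b⟩ ⟨c⟩
    exact congrArg (Quotient.mk _) (S.compat a b c)

theorem isHom_mk : IsHom S hI.quotient (Quotient.mk hI.setoid) :=
  ⟨fun _ _ => rfl, fun _ _ => rfl⟩

end IsIdeal

namespace IsFreeOn

variable {F : Type u} {X : Type v} {SF : SkewBrace F} {ι : X → F}

theorem hom_ext (hfree : IsFreeOn SF ι) {T : SkewBrace C} {f g : F → C} (hf : IsHom SF T f)
    (hg : IsHom SF T g) (h : ∀ x, f (ι x) = g (ι x)) : f = g :=
  (hfree C T fun x => g (ι x)).unique ⟨hf, h⟩ ⟨hg, fun _ => rfl⟩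

/-- Free skew braces are projective with respect to surjective homomorphisms. -/
theorem exists_lift (hfree : IsFreeOn SF ι) {S : SkewBrace B} {T : SkewBrace C}
    {f : F → C} (hf : IsHom SF T f) {p : B → C} (hp : IsHom S T p)
    (hsurj : Function.Surjective p) : ∃ g : F → B, IsHom SF S g ∧ ∀ x, p (g x) = f x := by
  choose s hs using hsurj
  obtain ⟨g, ⟨hg, hgι⟩, -⟩ := hfree B S fun x => s (f (ι x))
  exact ⟨g, hg, congrFun (hfree.hom_ext (hp.comp hg) hf fun x => by simp [hgι, hs])⟩

/-- An endomorphism of a free skew brace that moves the generators only modulo an ideal moves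
every element only modulo that ideal. -/
theorem exists_eq_add_mem (hfree : IsFreeOn SF ι) {e : F → F} (he : IsHom SF SF e) {I : Set F}
    (hI : SF.IsIdeal I) (h : ∀ x, SF.add (SF.neg (e (ι x))) (ι x) ∈ I) (y : F) :
    ∃ j ∈ I, y = SF.add (e y) j := by
  have heq := hfree.hom_ext (hI.isHom_mk.comp he) hI.isHom_mk fun x =>
    Quotient.sound ⟨_, h x, (SF.add_neg_cancel_left _ _).symm⟩
  exact Quotient.exact (congrFun heq y)

end IsFreeOn

end Basic

end SkewBrace

/-- **Independence of the presentation.** If a skew brace `B` is finitely presented by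
generators `a₁,…,a_m` (the images under `θ` of free generators `ι i`) subject to `n`
relations `R`, and `b : Fin l → B` is any other finite generating set of `B`, then
for any free skew brace `F'` on `l` generators and any homomorphism `θ' : F' → B`
sending the generators to the `b i`, the kernel of `θ'` is generated as an ideal by
at most `l + n` elements; so `B` is presented by `b₁,…,b_l` subject to `l + n`
relations. In particular the kernel of `θ'` is finitely generated as an ideal. -/
theorem finite_presentation_independent_of_generators {B : Type u}
    (S : SkewBrace B) {m n l : ℕ}
    (F : Type u) (SF : SkewBrace F) (ι : Fin m → F) (hfree : SkewBrace.IsFreeOn SF ι)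
    (θ : F → B) (hθ : SkewBrace.IsHom SF S θ) (hsurj : Function.Surjective θ)
    (R : Finset F) (hcard : R.card = n)
    (hker : {x | θ x = S.zero} = SF.idealGen ↑R)
    (b : Fin l → B) (hgen : S.subGen (Set.range b) = Set.univ)
    (F' : Type u) (SF' : SkewBrace F') (ι' : Fin l → F')
    (hfree' : SkewBrace.IsFreeOn SF' ι')
    (θ' : F' → B) (hθ' : SkewBrace.IsHom SF' S θ') (hθ'b : ∀ i, θ' (ι' i) = b i) :
    ∃ R' : Finset F', R'.card ≤ l + n ∧ {x | θ' x = S.zero} = SF'.idealGen ↑R' := by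
  classical
  have hsurj' : Function.Surjective θ' :=
    hθ'.surjective_of_subGen_eq_univ (by rintro _ ⟨i, rfl⟩; exact ⟨_, hθ'b i⟩) hgen
  obtain ⟨φ, hφ, hφθ⟩ := hfree.exists_lift hθ hθ' hsurj'
  obtain ⟨ψ, hψ, hψθ⟩ := hfree'.exists_lift hθ' hθ hsurj
  let d : Fin l → F' := fun i => SF'.add (SF'.neg (φ (ψ (ι' i)))) (ι' i)
  let R' : Finset F' := Finset.univ.image d ∪ R.image φ
  have hd : ∀ i, d i ∈ SF'.idealGen ↑R' := fun i =>
    SF'.subset_idealGen _ (by simp [R'])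
  have hR : SF.idealGen ↑R ⊆ φ ⁻¹' SF'.idealGen ↑R' :=
    SF.idealGen_subset (hφ.isIdeal_preimage (SF'.isIdeal_idealGen _)) fun r hr =>
      SF'.subset_idealGen _ (by
        have : φ r ∈ R' := Finset.mem_union_right _ (Finset.mem_image_of_mem φ hr)
        exact this)
  have hI := SF'.isIdeal_idealGen (R' : Set F')
  refine ⟨R', ?_, Set.Subset.antisymm (fun x hx => ?_)
    (SF'.idealGen_subset hθ'.isIdeal_ker fun y hy => ?_)⟩
  · calc R'.card ≤ (Finset.univ.image d).card + (R.image φ).card := Finset.card_union_le _ _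
      _ ≤ l + n := add_le_add (Finset.card_image_le.trans (by simp))
        (Finset.card_image_le.trans hcard.le)
  · obtain ⟨j, hj, hxj⟩ := hfree'.exists_eq_add_mem (hφ.comp hψ) hI hd x
    have hψx : ψ x ∈ SF.idealGen ↑R := hker ▸ (hψθ x).trans hx
    rw [hxj]
    exact hI.1.2.1 _ (hR hψx) _ hj
  · rcases Finset.mem_union.1 (Finset.mem_coe.1 hy) with h | h
    · obtain ⟨i, -, rfl⟩ := Finset.mem_image.1 h
      change θ' (SF'.add (SF'.neg (φ (ψ (ι' i)))) (ι' i)) = S.zero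
      rw [hθ'.1, hθ'.map_neg, hφθ, hψθ, S.neg_add]
    · obtain ⟨r, hr, rfl⟩ := Finset.mem_image.1 h
      have : r ∈ {x | θ x = S.zero} := hker ▸ SF.subset_idealGen _ hr
      exact (hφθ r).trans this
end

section
/- Let B be a skew brace and let x ∈ B be an element satisfying x∗x = 0, x∗(−x) = 0 and (−x)∗(−x) = 0, where a∗b = −a + a∘b − b. Then x^ℓ = ℓx for every integer ℓ, where x^ℓ denotes the ℓ-th power of x in (B,∘) and ℓx denotes the ℓ-th multiple of x in (B,+); in particular x∘x = x+x and x^{-1} = −x. -/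
universe u v

/-- The `n`-th power of `x` in the group `(B,∘)`. -/
def SkewBrace.mulPow {B : Type u} (S : SkewBrace B) (x : B) : ℕ → B
  | 0 => S.zero
  | n + 1 => S.mul x (S.mulPow x n)

/-- The `ℓ`-th power of `x` in the group `(B,∘)`, for `ℓ : ℤ`. -/
def SkewBrace.mulZPow {B : Type u} (S : SkewBrace B) (x : B) : ℤ → B
  | Int.ofNat n => S.mulPow x n
  | Int.negSucc n => S.inv (S.mulPow x (n + 1))

/-- The `n`-th multiple of `x` in the group `(B,+)`. -/
def SkewBrace.addNSmul {B : Type u} (S : SkewBrace B) (x : B) : ℕ → B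
  | 0 => S.zero
  | n + 1 => S.add x (S.addNSmul x n)

/-- The `ℓ`-th multiple of `x` in the group `(B,+)`, for `ℓ : ℤ`. -/
def SkewBrace.addZSmul {B : Type u} (S : SkewBrace B) (x : B) : ℤ → B
  | Int.ofNat n => S.addNSmul x n
  | Int.negSucc n => S.neg (S.addNSmul x (n + 1))

namespace SkewBrace

variable {B : Type u} (S : SkewBrace B)

/-- The additive group `(B,+)` of a skew brace. -/
abbrev toAddGroup : AddGroup B :=
  letI : Add B := ⟨S.add⟩
  letI : Zero B := ⟨S.zero⟩
  letI : Neg B := ⟨S.neg⟩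
  AddGroup.ofLeftAxioms S.add_assoc S.zero_add S.neg_add

/-- The multiplicative group `(B,∘)` of a skew brace. -/
abbrev toGroup : Group B :=
  letI : Mul B := ⟨S.mul⟩
  letI : One B := ⟨S.zero⟩
  letI : Inv B := ⟨S.inv⟩
  Group.ofLeftAxioms S.mul_assoc S.zero_mul S.inv_mul

theorem mulPow_eq_pow (x : B) (n : ℕ) :
    letI := S.toGroup
    S.mulPow x n = x ^ n := by
  let := S.toGroup
  induction n with
  | zero => exact (pow_zero x).symm
  | succ n ih =>
    show S.mul x (S.mulPow x n) = x ^ (n + 1)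
    rw [pow_succ', ← ih]
    rfl

theorem addNSmul_eq_nsmul (x : B) (n : ℕ) :
    letI := S.toAddGroup
    S.addNSmul x n = n • x := by
  let := S.toAddGroup
  induction n with
  | zero => exact (zero_nsmul x).symm
  | succ n ih =>
    show S.add x (S.addNSmul x n) = (n + 1) • x
    rw [succ_nsmul', ← ih]
    rfl

theorem inv_mulPow (x : B) (n : ℕ) : S.inv (S.mulPow x n) = S.mulPow (S.inv x) n := by
  let := S.toGroup
  rw [mulPow_eq_pow, mulPow_eq_pow]
  exact (inv_pow x n).symm

theorem neg_addNSmul (x : B) (n : ℕ) : S.neg (S.addNSmul x n) = S.addNSmul (S.neg x) n := by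
  let := S.toAddGroup
  rw [addNSmul_eq_nsmul, addNSmul_eq_nsmul]
  exact (neg_nsmul x n).symm

theorem star_eq_zero_iff {a b : B} : S.star a b = S.zero ↔ S.mul a b = S.add a b := by
  let := S.toAddGroup
  show -a + S.mul a b + -b = 0 ↔ S.mul a b = a + b
  rw [add_neg_eq_zero, neg_add_eq_iff_eq_add]

theorem inv_eq_of_mul_eq_zero {a b : B} (h : S.mul a b = S.zero) : S.inv a = b := by
  let := S.toGroup
  exact inv_eq_of_mul_eq_one_right h

theorem mulPow_eq_addNSmul {x : B} (h : S.star x x = S.zero) (n : ℕ) :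
    S.mulPow x n = S.addNSmul x n := by
  have mul_addNSmul (n : ℕ) : S.mul x (S.addNSmul x n) = S.add x (S.addNSmul x n) := by
    induction n with
    | zero => exact (S.mul_zero x).trans (S.add_zero x).symm
    | succ n ih =>
      show S.mul x (S.add x (S.addNSmul x n)) = S.add x (S.add x (S.addNSmul x n))
      rw [S.compat, S.star_eq_zero_iff.mp h, ih, S.add_assoc x x, S.add_neg, S.add_zero]
  induction n with
  | zero => rfl
  | succ n ih =>
    show S.mul x (S.mulPow x n) = S.add x (S.addNSmul x n)
    rw [ih, mul_addNSmul]

end SkewBrace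

/-- **Lemma.** Let `B` be a skew brace and `x ∈ B` with `x ∗ x = 0`, `x ∗ (-x) = 0`
and `(-x) ∗ (-x) = 0`. Then `x^ℓ = ℓ·x` for every integer `ℓ` (powers in `(B,∘)`,
multiples in `(B,+)`); in particular `x ∘ x = x + x` and `x⁻¹ = -x`. -/
theorem pow_eq_smul_of_star_self_zero {B : Type u} (S : SkewBrace B) (x : B)
    (h1 : S.star x x = S.zero) (h2 : S.star x (S.neg x) = S.zero)
    (h3 : S.star (S.neg x) (S.neg x) = S.zero) :
    (∀ ℓ : ℤ, S.mulZPow x ℓ = S.addZSmul x ℓ) ∧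
      S.mul x x = S.add x x ∧ S.inv x = S.neg x := by
  have inv_eq : S.inv x = S.neg x :=
    S.inv_eq_of_mul_eq_zero ((S.star_eq_zero_iff.mp h2).trans (S.add_neg x))
  refine ⟨fun ℓ => ?_, S.star_eq_zero_iff.mp h1, inv_eq⟩
  cases ℓ with
  | ofNat n => exact S.mulPow_eq_addNSmul h1 n
  | negSucc n =>
    show S.inv (S.mulPow x (n + 1)) = S.neg (S.addNSmul x (n + 1))
    rw [S.inv_mulPow, S.neg_addNSmul, inv_eq, S.mulPow_eq_addNSmul h3]
end
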